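/- arXiv:1209.4218 — 4 statements merged into one kernel-verified Lean document; each statement's English description precedes it below -/
import Mathlib

section
/- (Lemma 1, second part) Let a, σ², P > 0 and for g > 0 define p*(g) = min(aσ²/g, P) and U(g) = exp(−aσ²/(g·p*(g)))/p*(g), the per-user energy-efficiency utility evaluated at the individual optimal power. Then U is monotone nondecreasing: for all 0 < g_j ≤ g_i, U(g_j) ≤ U(g_i). -/
/-- If the threshold `c` decreases, then so does the ratio `c / min c P`. -/
lemma div_min_le_div_min {c d P : ℝ} (hc : 0 < c) (hcd : c ≤ d) (hP : 0 < P) :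
    c / min c P ≤ d / min d P := by
  have hd : 0 < d := hc.trans_le hcd
  rw [div_le_div_iff₀ (lt_min hc hP) (lt_min hd hP), mul_min_of_nonneg _ _ hc.le,
    mul_min_of_nonneg _ _ hd.le, mul_comm d c]
  exact min_le_min le_rfl (mul_le_mul_of_nonneg_right hcd hP.le)

/-- (Lemma 1, second part) For `a, σ², P > 0`, with `p*(g) = min(aσ²/g, P)` and
`U(g) = exp(-aσ²/(g·p*(g)))/p*(g)`, the map `U` is monotone nondecreasing:
if `0 < g_j ≤ g_i` then `U(g_j) ≤ U(g_i)`. -/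
theorem stmt_5 (a σ2 P : ℝ) (ha : 0 < a) (hσ : 0 < σ2) (hP : 0 < P) :
    ∀ gj gi : ℝ, 0 < gj → gj ≤ gi →
      Real.exp (-(a * σ2) / (gj * min (a * σ2 / gj) P)) / min (a * σ2 / gj) P ≤
        Real.exp (-(a * σ2) / (gi * min (a * σ2 / gi) P)) / min (a * σ2 / gi) P := by
  intro gj gi hj hji
  have hi : 0 < gi := hj.trans_le hji
  have hc : 0 < a * σ2 / gi := by positivity
  have hcd : a * σ2 / gi ≤ a * σ2 / gj := by gcongr
  rw [← div_div, ← div_div, neg_div, neg_div, neg_div, neg_div]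
  exact div_le_div₀ (Real.exp_pos _).le
    (Real.exp_le_exp.2 (neg_le_neg (div_min_le_div_min hc hcd hP)))
    (lt_min hc hP) (min_le_min hcd le_rfl)
end

section
/- For every c > 0, the function u_c(p) = exp(−c/p)/p is quasiconcave on the set (0, ∞): for all p, q ∈ (0, ∞) and t ∈ [0, 1], u_c(t·p + (1−t)·q) ≥ min(u_c(p), u_c(q)). -/
/-- The perspective function `p ↦ p * exp (c / p)` of the exponential is convex on `(0, ∞)`. -/
theorem convexOn_mul_exp_div (c : ℝ) :
    ConvexOn ℝ (Set.Ioi 0) fun p : ℝ => p * Real.exp (c / p) := by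
  refine ⟨convex_Ioi 0, fun x hx y hy a b ha hb hab => ?_⟩
  have hs : 0 < a • x + b • y := convex_Ioi (0 : ℝ) hx hy ha hb hab
  have hx : 0 < x := hx
  have hy : 0 < y := hy
  simp only [smul_eq_mul] at hs ⊢
  set s := a * x + b * y with hs_def
  have h := convexOn_exp.2 (Set.mem_univ (c / x)) (Set.mem_univ (c / y))
    (show 0 ≤ a * x / s by positivity) (show 0 ≤ b * y / s by positivity)
    (by rw [← add_div, ← hs_def, div_self hs.ne'])
  simp only [smul_eq_mul] at h
  have harg : a * x / s * (c / x) + b * y / s * (c / y) = c / s := by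
    rw [← one_mul (c / s), ← hab]
    field_simp
  rw [harg] at h
  calc s * Real.exp (c / s)
      ≤ s * (a * x / s * Real.exp (c / x) + b * y / s * Real.exp (c / y)) := by gcongr
    _ = a * (x * Real.exp (c / x)) + b * (y * Real.exp (c / y)) := by
      field_simp

theorem exp_neg_div_div_eq_inv (c p : ℝ) :
    Real.exp (-c / p) / p = (p * Real.exp (c / p))⁻¹ := by
  rw [neg_div, Real.exp_neg, mul_inv, div_eq_mul_inv, mul_comm]

/-- For every `c > 0`, `u_c(p) = exp(-c/p)/p` is quasiconcave on `(0, ∞)`: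
for all `p, q > 0` and `t ∈ [0, 1]`,
`u_c(t·p + (1-t)·q) ≥ min(u_c(p), u_c(q))`. -/
theorem stmt_6 (c : ℝ) (hc : 0 < c) :
    ∀ p q t : ℝ, 0 < p → 0 < q → 0 ≤ t → t ≤ 1 →
      min (Real.exp (-c / p) / p) (Real.exp (-c / q) / q) ≤
        Real.exp (-c / (t * p + (1 - t) * q)) / (t * p + (1 - t) * q) := by
  intro p q t hp hq ht ht1
  have hs : 0 < t * p + (1 - t) * q :=
    convex_Ioi (0 : ℝ) hp hq ht (sub_nonneg.2 ht1) (add_sub_cancel t 1)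
  have h := (convexOn_mul_exp_div c).le_on_segment' hp hq ht (sub_nonneg.2 ht1)
    (add_sub_cancel t 1)
  simp only [smul_eq_mul] at h
  simp only [exp_neg_div_div_eq_inv]
  rcases le_max_iff.1 h with h | h
  · exact (min_le_left _ _).trans (inv_anti₀ (by positivity) h)
  · exact (min_le_right _ _).trans (inv_anti₀ (by positivity) h)
end

section
/- (Slope-equality optimality condition) Let K ≥ 1, P > 0, c_1, …, c_K > 0, and define ũ_k(p) = exp(−c_k/p)/p for p > 0 and ũ_k(0) = 0. Suppose p̄ maximizes Σ_k ũ_k(p_k) over D = { p : p_k ≥ 0, Σ_k p_k ≤ P }, and let i ≠ j be indices with p̄_i > 0 and p̄_j > 0. Then the derivatives coincide: exp(−c_i/p̄_i)·(c_i − p̄_i)/p̄_i³ = exp(−c_j/p̄_j)·(c_j − p̄_j)/p̄_j³. -/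
open Filter Topology in
/-- At a maximizer of a separable function over the nonnegative vectors of bounded sum, the
derivatives along any two positive coordinates coincide. -/
theorem deriv_eq_of_separable_max {ι : Type*} [Fintype ι] {f : ι → ℝ → ℝ} {p : ι → ℝ} {P : ℝ}
    (hnonneg : ∀ k, 0 ≤ p k) (hsum : ∑ k, p k ≤ P)
    (hmax : ∀ q : ι → ℝ, ((∀ k, 0 ≤ q k) ∧ ∑ k, q k ≤ P) → ∑ k, f k (q k) ≤ ∑ k, f k (p k))
    {i j : ι} (hij : i ≠ j) (hi : 0 < p i) (hj : 0 < p j) {a b : ℝ}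
    (ha : HasDerivAt (f i) a (p i)) (hb : HasDerivAt (f j) b (p j)) : a = b := by
  classical
  set d : ι → ℝ := fun k => (if k = i then 1 else 0) - (if k = j then 1 else 0) with hd
  have hdi : d i = 1 := by simp [hd, hij]
  have hdj : d j = -1 := by simp [hd, hij.symm]
  have hdk : ∀ k, k ≠ i → k ≠ j → d k = 0 := fun k h1 h2 => by simp [hd, h1, h2]
  have hdsum : ∑ k, d k = 0 := by simp [hd]
  have hderiv : HasDerivAt (fun t : ℝ => ∑ k, f k (p k + t * d k))
      (∑ k, ((if k = i then a else 0) - (if k = j then b else 0))) 0 := by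
    refine HasDerivAt.fun_sum fun k _ => ?_
    have hline : HasDerivAt (fun t : ℝ => p k + t * d k) (d k) 0 := by
      simpa using ((hasDerivAt_id (0 : ℝ)).mul_const (d k)).const_add (p k)
    by_cases hki : k = i
    · subst hki
      have h := HasDerivAt.comp (h₂ := f k) (h₂' := a) 0 (by simpa using ha) hline
      simpa [hdi, hij, Function.comp_def] using h
    · by_cases hkj : k = j
      · subst hkj
        have h := HasDerivAt.comp (h₂ := f k) (h₂' := b) 0 (by simpa using hb) hline
        simpa [hdj, hij.symm, Function.comp_def] using h
      · simpa [hki, hkj, hdk k hki hkj] using hasDerivAt_const (0 : ℝ) (f k (p k))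
  have hloc : IsLocalMax (fun t : ℝ => ∑ k, f k (p k + t * d k)) 0 := by
    filter_upwards [Ioo_mem_nhds (neg_lt_zero.mpr hi) hj] with t ht
    have hfeas := hmax (fun k => p k + t * d k) ⟨fun k => ?_, ?_⟩
    · simpa using hfeas
    · by_cases hki : k = i
      · subst hki
        simp only [hdi]
        linarith [ht.1]
      · by_cases hkj : k = j
        · subst hkj
          simp only [hdj]
          linarith [ht.2]
        · simpa [hdk k hki hkj] using hnonneg k
    · simpa [Finset.sum_add_distrib, ← Finset.mul_sum, hdsum] using hsum
  have hzero := hloc.hasDerivAt_eq_zero hderiv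
  simp only [Finset.sum_sub_distrib, Finset.sum_ite_eq', Finset.mem_univ, if_true] at hzero
  linarith

/-- The derivative of the energy-efficiency utility at a positive power. -/
theorem hasDerivAt_energyEfficiency (c : ℝ) {x : ℝ} (hx : 0 < x) :
    HasDerivAt (fun p : ℝ => if 0 < p then Real.exp (-c / p) / p else 0)
      (Real.exp (-c / x) * (c - x) / x ^ 3) x := by
  have hinner : HasDerivAt (fun p : ℝ => -c / p) (c / x ^ 2) x := by
    simpa using (hasDerivAt_const x (-c)).fun_div (hasDerivAt_id x) hx.ne'
  have h := hinner.exp.fun_div (hasDerivAt_id x) hx.ne'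
  refine (h.congr_deriv ?_).congr_of_eventuallyEq ?_
  · simp only [id_eq]
    field_simp
  · filter_upwards [lt_mem_nhds hx] with p hp
    simp [hp]

/-- (Slope-equality optimality condition) If `p̄` maximizes `Σ_k ũ_k(p_k)` over
`D = { p : p_k ≥ 0, Σ_k p_k ≤ P }`, and `i ≠ j` with `p̄_i > 0` and `p̄_j > 0`, then the
derivatives of `ũ_i` at `p̄_i` and of `ũ_j` at `p̄_j` coincide. -/
theorem stmt_12 (K : ℕ) (hK : 1 ≤ K) (P : ℝ) (hP : 0 < P)
    (c : Fin K → ℝ) (hc : ∀ k, 0 < c k) (pbar : Fin K → ℝ)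
    (hmem : (∀ k, 0 ≤ pbar k) ∧ ∑ k, pbar k ≤ P)
    (hmax : ∀ p : Fin K → ℝ, ((∀ k, 0 ≤ p k) ∧ ∑ k, p k ≤ P) →
      ∑ k, (if 0 < p k then Real.exp (-c k / p k) / p k else 0) ≤
        ∑ k, (if 0 < pbar k then Real.exp (-c k / pbar k) / pbar k else 0))
    (i j : Fin K) (hij : i ≠ j) (hi : 0 < pbar i) (hj : 0 < pbar j) :
    Real.exp (-c i / pbar i) * (c i - pbar i) / pbar i ^ 3 =
      Real.exp (-c j / pbar j) * (c j - pbar j) / pbar j ^ 3 := by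
  exact deriv_eq_of_separable_max
    (f := fun k x => if 0 < x then Real.exp (-c k / x) / x else 0) hmem.1 hmem.2 hmax hij hi hj
    (hasDerivAt_energyEfficiency (c i) hi) (hasDerivAt_energyEfficiency (c j) hj)
end

section
/- (Optimality of the individual optimal powers when the power budget is not saturated) Let K ≥ 1, a, σ², P > 0 and channel gains g_1, …, g_K > 0. Set p*_k = min(aσ²/g_k, P) and define ũ_k(p) = exp(−aσ²/(g_k·p))/p for p > 0 and ũ_k(0) = 0. If Σ_{k=1}^K p*_k ≤ P, then the vector (p*_1, …, p*_K) maximizes Σ_k ũ_k(p_k) over the feasible set D = { p : p_k ≥ 0 for all k, Σ_k p_k ≤ P }. -/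
/-- The map `x ↦ exp (-c / x) / x` attains its maximum over `(0, P]` at `min c P`. -/
theorem exp_neg_div_div_le_min {c P x : ℝ} (hc : 0 < c) (hx : 0 < x) (hxP : x ≤ P) :
    Real.exp (-(c / x)) / x ≤ Real.exp (-(c / min c P)) / min c P := by
  have hm : 0 < min c P := lt_min hc (hx.trans_le hxP)
  have key : 0 ≤ (min c P - x) * (c - min c P) := by
    rcases le_total c P with h | h
    · simp [min_eq_left h]
    · rw [min_eq_right h]
      exact mul_nonneg (sub_nonneg.2 hxP) (sub_nonneg.2 h)
  generalize min c P = m at hm key ⊢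
  have hratio : m / x ≤ c / x - c / m + 1 := by
    rw [← sub_nonneg]
    have : c / x - c / m + 1 - m / x = (m - x) * (c - m) / (x * m) := by
      field_simp
      ring
    rw [this]
    positivity
  have hexp : m / x ≤ Real.exp (c / x - c / m) := hratio.trans (Real.add_one_le_exp _)
  rw [div_le_div_iff₀ hx hm]
  calc Real.exp (-(c / x)) * m = Real.exp (-(c / x)) * (m / x) * x := by field_simp
    _ ≤ Real.exp (-(c / x)) * Real.exp (c / x - c / m) * x := by gcongr
    _ = Real.exp (-(c / m)) * x := by
      rw [← Real.exp_add]
      ring_nf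

/-- (Optimality of the individual optimal powers when the power budget is not saturated)
If `Σ_k p*_k ≤ P` with `p*_k = min(aσ²/g_k, P)`, then `(p*_1, …, p*_K)` maximizes the
cell utility `Σ_k ũ_k(p_k)` over `D = { p : p_k ≥ 0, Σ_k p_k ≤ P }`. -/
theorem stmt_13 (K : ℕ) (hK : 1 ≤ K) (a σ2 P : ℝ) (ha : 0 < a) (hσ : 0 < σ2) (hP : 0 < P)
    (g : Fin K → ℝ) (hg : ∀ k, 0 < g k)
    (hsum : ∑ k, min (a * σ2 / g k) P ≤ P) :
    ∀ p : Fin K → ℝ, ((∀ k, 0 ≤ p k) ∧ ∑ k, p k ≤ P) →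
      ∑ k, (if 0 < p k then Real.exp (-(a * σ2) / (g k * p k)) / p k else 0) ≤
        ∑ k, Real.exp (-(a * σ2) / (g k * min (a * σ2 / g k) P)) / min (a * σ2 / g k) P := by
  rintro p ⟨hp, hpP⟩
  refine Finset.sum_le_sum fun k _ => ?_
  have hc : 0 < a * σ2 / g k := div_pos (mul_pos ha hσ) (hg k)
  have hpk : p k ≤ P :=
    (Finset.single_le_sum (fun i _ => hp i) (Finset.mem_univ k)).trans hpP
  split_ifs with h
  · simpa only [neg_div, div_div] using exp_neg_div_div_le_min hc h hpk
  · have hm : 0 < min (a * σ2 / g k) P := lt_min hc hP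
    positivity
end
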